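/- (Theorem 2.1(ii).) Under Assumption 2.1, fix 1 ≤ a, b ≤ p with a ≠ b and let P_{ab} be the orthogonal projection onto the closed linear span of {x_{(s,c)} : s ∈ ℤ, c ∉ {a,b}}. Then the Gram operator of the residual family {x_{(t,c)} − P_{ab} x_{(t,c)} : t ∈ ℤ, c ∈ {a,b}} equals the inverse of the 2×2 block operator [[D_{a,a}, D_{a,b}],[D_{b,a}, D_{b,b}]] on ℓ²(ℤ) ⊕ ℓ²(ℤ); in particular, for all t, τ, the cross-partial covariance ⟨x_{(t,a)} − P_{ab}x_{(t,a)}, x_{(τ,b)} − P_{ab}x_{(τ,b)}⟩ equals the (t,τ) entry of −(D_{a,a} − D_{a,b}D_{b,b}^{-1}D_{b,a})^{-1} D_{a,b} D_{b,b}^{-1}, and the a-marginal partial covariance ⟨x_{(t,a)} − P_{ab}x_{(t,a)}, x_{(τ,a)} − P_{ab}x_{(τ,a)}⟩ equals the (t,τ) entry of (D_{a,a} − D_{a,b}D_{b,b}^{-1}D_{b,a})^{-1}. -/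

import Mathlib

open scoped InnerProductSpace

noncomputable section

abbrev Ell2p (p : ℕ) : Type := lp (fun _ : ℤ × Fin p => ℝ) 2

noncomputable def e2p (p : ℕ) (i : ℤ × Fin p) : Ell2p p := lp.single 2 i 1

abbrev Ell2Z : Type := lp (fun _ : ℤ => ℝ) 2

noncomputable def eZ (t : ℤ) : Ell2Z := lp.single 2 t 1

def gramQuadSet {H : Type*} [NormedAddCommGroup H] [InnerProductSpace ℝ H]
    {p : ℕ} (x : ℤ × Fin p → H) : Set ℝ :=
  {r : ℝ | ∃ v : (ℤ × Fin p) →₀ ℝ,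
      (∑ i ∈ v.support, (v i) ^ 2) = 1 ∧ ‖∑ i ∈ v.support, v i • x i‖ ^ 2 = r}

def IsResidual {H : Type*} [NormedAddCommGroup H] [InnerProductSpace ℝ H]
    (S : Set H) (y r : H) : Prop :=
  (y - r) ∈ (Submodule.span ℝ S).topologicalClosure ∧ ∀ z ∈ S, ⟪r, z⟫_ℝ = 0



lemma h8_hasSum {ι : Type*} [DecidableEq ι] (w : lp (fun _ : ι => ℝ) 2) :
    HasSum (fun i => w i • (lp.single 2 i (1:ℝ) : lp (fun _ : ι => ℝ) 2)) w := by
  have h := lp.hasSum_single (E := fun _ : ι => ℝ) (p := 2) (by norm_num) w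
  convert h using 2 with i
  rw [← lp.single_smul]; simp

lemma h8_inner {ι : Type*} [DecidableEq ι] (w : lp (fun _ : ι => ℝ) 2) (i : ι) :
    ⟪w, (lp.single 2 i (1:ℝ) : lp (fun _ : ι => ℝ) 2)⟫_ℝ = w i := by
  rw [lp.inner_single_right]; simp

lemma h8_vec_ext {u v : Ell2Z} (h : ∀ t, ⟪u, eZ t⟫_ℝ = ⟪v, eZ t⟫_ℝ) : u = v := by
  ext t
  have := h t
  simpa only [eZ, h8_inner] using this

lemma h8_vec_ext' {p : ℕ} {u v : Ell2p p} (h : ∀ t, ⟪u, e2p p t⟫_ℝ = ⟪v, e2p p t⟫_ℝ) : u = v := by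
  ext t
  have := h t
  simpa only [e2p, h8_inner] using this

lemma h8_clm_ext {F : Type*} [NormedAddCommGroup F] [InnerProductSpace ℝ F]
    {A B : Ell2Z →L[ℝ] F} (h : ∀ τ, A (eZ τ) = B (eZ τ)) : A = B := by
  ext1 w
  have hw := h8_hasSum w
  have h1 := A.hasSum hw
  have h2 := B.hasSum hw
  refine h1.unique ?_
  convert h2 using 2 with i
  have := h i
  simp only [eZ] at this
  simp [this]

lemma h8_synth {H : Type*} [NormedAddCommGroup H] [InnerProductSpace ℝ H] [CompleteSpace H]
    (p : ℕ) (x : ℤ × Fin p → H) (C : Ell2p p →L[ℝ] Ell2p p)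
    (hC : ∀ i j : ℤ × Fin p, ⟪C (e2p p j), e2p p i⟫_ℝ = ⟪x i, x j⟫_ℝ) (w : Ell2p p)
    (S : Set (ℤ × Fin p)) (hS : ∀ i, i ∉ S → w i = 0) :
    ∃ y : H, (∀ k, ⟪x k, y⟫_ℝ = ⟪C w, e2p p k⟫_ℝ) ∧
      y ∈ (Submodule.span ℝ (x '' S)).topologicalClosure := by
  have hw : HasSum (fun i => w i • e2p p i) w := h8_hasSum w
  have key : ∀ s : Finset (ℤ × Fin p),
      ‖∑ i ∈ s, w i • x i‖ ^ 2 ≤ ‖C‖ * ‖∑ i ∈ s, w i • e2p p i‖ ^ 2 := by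
    intro s
    have e1 : ‖∑ i ∈ s, w i • x i‖ ^ 2
        = ⟪C (∑ i ∈ s, w i • e2p p i), ∑ i ∈ s, w i • e2p p i⟫_ℝ := by
      rw [← real_inner_self_eq_norm_sq]
      simp only [map_sum, map_smul, sum_inner, inner_sum, inner_smul_left, inner_smul_right, hC]
      refine Finset.sum_congr rfl fun i _ => congrArg _ (Finset.sum_congr rfl fun j _ => ?_)
      rw [real_inner_comm]
    rw [e1]
    refine (real_inner_le_norm _ _).trans ?_
    have := C.le_opNorm (∑ i ∈ s, w i • e2p p i)
    nlinarith [norm_nonneg (∑ i ∈ s, w i • e2p p i)]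
  have hsum : Summable (fun i => w i • x i) := by
    rw [summable_iff_vanishing_norm]
    intro ε hε
    obtain ⟨s, hs⟩ := (summable_iff_vanishing_norm.1 hw.summable) (ε / (‖C‖ + 1)) (by positivity)
    refine ⟨s, fun t ht => ?_⟩
    have h1 := hs t ht
    have h2 := key t
    rw [lt_div_iff₀ (by positivity)] at h1
    refine lt_of_le_of_lt ?_ h1
    refine abs_le_of_sq_le_sq' ?_ (by positivity) |>.2
    refine h2.trans ?_
    nlinarith [norm_nonneg C, sq_nonneg ‖∑ i ∈ t, w i • e2p p i‖, mul_nonneg (norm_nonneg C) (sq_nonneg ‖∑ i ∈ t, w i • e2p p i‖), mul_nonneg (sq_nonneg ‖C‖) (sq_nonneg ‖∑ i ∈ t, w i • e2p p i‖)]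
  obtain ⟨y, hy⟩ := hsum
  refine ⟨y, fun k => ?_, ?_⟩
  · have h1 := (innerSL ℝ (x k)).hasSum hy
    have h2 := (innerSL ℝ (e2p p k)).hasSum (C.hasSum hw)
    have h3 := h1.unique (a₂ := innerSL ℝ (e2p p k) (C w)) (by
      convert h2 using 2 with i
      simp only [map_smul, innerSL_apply_apply]
      rw [real_inner_comm (C (e2p p i)), hC])
    rw [real_inner_comm (e2p p k)]; exact h3
  · refine (Submodule.isClosed_topologicalClosure _).mem_of_tendsto hy (Filter.Eventually.of_forall fun s => ?_)
    refine Submodule.sum_mem _ fun i _ => ?_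
    by_cases hi : i ∈ S
    · exact Submodule.smul_mem _ _ (Submodule.le_topologicalClosure _ (Submodule.subset_span ⟨i, hi, rfl⟩))
    · rw [hS i hi, zero_smul]; exact Submodule.zero_mem _

lemma h8_orth {H : Type*} [NormedAddCommGroup H] [InnerProductSpace ℝ H]
    {S : Set H} {z r : H} (hz : z ∈ (Submodule.span ℝ S).topologicalClosure)
    (hr : ∀ s ∈ S, ⟪r, s⟫_ℝ = 0) : ⟪z, r⟫_ℝ = 0 := by
  have h1 : r ∈ (Submodule.span ℝ S)ᗮ := by
    rw [Submodule.mem_orthogonal']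
    intro u hu
    induction hu using Submodule.span_induction with
    | mem x h => exact hr x h
    | zero => simp
    | add x y _ _ h1 h2 => rw [inner_add_right, h1, h2, add_zero]
    | smul c x _ h => rw [inner_smul_right, h, mul_zero]
  have h2 : (Submodule.span ℝ S).topologicalClosure ≤ (Submodule.span ℝ S)ᗮᗮ :=
    Submodule.topologicalClosure_minimal _ (Submodule.le_orthogonal_orthogonal _)
      (Submodule.isClosed_orthogonal _)
  have := h2 hz
  rw [Submodule.mem_orthogonal'] at this
  exact this r h1

lemma h8_res {H : Type*} [NormedAddCommGroup H] [InnerProductSpace ℝ H] [CompleteSpace H]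
    (p : ℕ) (x : ℤ × Fin p → H) (C : Ell2p p →L[ℝ] Ell2p p)
    (hC : ∀ i j : ℤ × Fin p, ⟪C (e2p p j), e2p p i⟫_ℝ = ⟪x i, x j⟫_ℝ)
    (S : Set (ℤ × Fin p)) (j : ℤ × Fin p) (w : Ell2p p)
    (hw : ∀ i, i ∉ S → ⟪w, e2p p i⟫_ℝ = ⟪e2p p j, e2p p i⟫_ℝ)
    (hCw : ∀ k ∈ S, ⟪C w, e2p p k⟫_ℝ = 0)
    (r : H) (hr : IsResidual (x '' S) (x j) r)
    (i : ℤ × Fin p) (r' : H) (hr' : IsResidual (x '' S) (x i) r') :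
    ⟪r', r⟫_ℝ = ⟪C w, e2p p i⟫_ℝ := by
  obtain ⟨y, hy1, hy2⟩ := h8_synth p x C hC (w - e2p p j) S (by
    intro i hi
    have := hw i hi
    rw [← h8_inner]
    change ⟪w - e2p p j, e2p p i⟫_ℝ = 0
    rw [inner_sub_left, this, sub_self])
  have hq : ∀ k, ⟪x k, y + x j⟫_ℝ = ⟪C w, e2p p k⟫_ℝ := by
    intro k
    rw [inner_add_right, hy1, map_sub, inner_sub_left, hC]; ring
  have hq0 : ∀ s ∈ x '' S, ⟪y + x j, s⟫_ℝ = 0 := by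
    rintro _ ⟨k, hk, rfl⟩
    rw [real_inner_comm, hq, hCw k hk]
  have hreq : r = y + x j := by
    have hz : (y + x j) - r ∈ (Submodule.span ℝ (x '' S)).topologicalClosure := by
      have := Submodule.add_mem _ hy2 hr.1
      rwa [← add_sub_assoc] at this
    have h0 := h8_orth hz (r := (y + x j) - r) (by
      intro s hs
      rw [inner_sub_left, hq0 s hs, hr.2 s hs, sub_zero])
    rw [inner_self_eq_zero, sub_eq_zero] at h0
    exact h0.symm
  have h1 := h8_orth hr'.1 hr.2
  rw [inner_sub_left, sub_eq_zero] at h1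
  rw [← h1, hreq, hq]

lemma h8_orthonormal (p : ℕ) : Orthonormal ℝ (e2p p) := by
  rw [orthonormal_iff_ite]
  intro i j
  rw [e2p, e2p, h8_inner]
  simp [lp.single_apply, Pi.single_apply, eq_comm]

lemma h8_J (p : ℕ) (a : Fin p) : ∃ J : Ell2Z →L[ℝ] Ell2p p, ∀ t, J (eZ t) = e2p p (t, a) := by
  have ho : Orthonormal ℝ (fun t : ℤ => e2p p (t, a)) :=
    (h8_orthonormal p).comp (fun t : ℤ => (t, a)) (fun _ _ h => congrArg Prod.fst h)
  refine ⟨ho.orthogonalFamily.linearIsometry.toContinuousLinearMap, fun t => ?_⟩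
  simp [eZ]

lemma h8_ring {R : Type*} [Ring R] {A B C E F T : R} (h1 : E * F = 1) (h2 : F * E = 1)
    (h3 : (A - B * (F * C)) * T = 1) (h4 : T * (A - B * (F * C)) = 1) :
    A * T + B * (-(F * C * T)) = 1 ∧
    A * (-(T * (B * F))) + B * (F + F * C * T * B * F) = 0 ∧
    C * T + E * (-(F * C * T)) = 0 ∧
    C * (-(T * (B * F))) + E * (F + F * C * T * B * F) = 1 ∧
    T * A + (-(T * (B * F))) * C = 1 ∧
    T * B + (-(T * (B * F))) * E = 0 ∧
    (-(F * C * T)) * A + (F + F * C * T * B * F) * C = 0 ∧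
    (-(F * C * T)) * B + (F + F * C * T * B * F) * E = 1 := by
  have k1 : ∀ X, E * (F * X) = X := fun X => by rw [← mul_assoc, h1, one_mul]
  have h3' : A * T = 1 + B * (F * (C * T)) := by
    rw [sub_mul, sub_eq_iff_eq_add] at h3; rw [h3]; noncomm_ring
  have h4' : T * A = 1 + T * (B * (F * C)) := by
    rw [mul_sub, sub_eq_iff_eq_add] at h4; rw [h4]
  have h3'' : ∀ X, A * (T * X) = X + B * (F * (C * (T * X))) := fun X => by
    rw [← mul_assoc, h3']; noncomm_ring
  refine ⟨?_, ?_, ?_, ?_, ?_, ?_, ?_, ?_⟩ <;>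
    simp only [mul_add, add_mul, mul_neg, neg_mul, mul_assoc, h1, h2, k1, h3', h4', h3'', mul_one] <;> abel

lemma h8_J_inner {p : ℕ} {a : Fin p} {J : Ell2Z →L[ℝ] Ell2p p}
    (hJ : ∀ t, J (eZ t) = e2p p (t, a)) (f : Ell2Z) :
    (∀ t, ⟪J f, e2p p (t, a)⟫_ℝ = ⟪f, eZ t⟫_ℝ) ∧
    (∀ k : ℤ × Fin p, k.2 ≠ a → ⟪J f, e2p p k⟫_ℝ = 0) := by
  have ho := orthonormal_iff_ite.1 (h8_orthonormal p)
  have key : ∀ (k : ℤ × Fin p) (g : Ell2Z),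
      (∀ τ, ⟪e2p p (τ, a), e2p p k⟫_ℝ = ⟪eZ τ, g⟫_ℝ) → ⟪J f, e2p p k⟫_ℝ = ⟪f, g⟫_ℝ := by
    intro k g h
    have : (innerSL ℝ (e2p p k)).comp J = innerSL ℝ g := by
      apply h8_clm_ext
      intro τ
      have := h τ
      rw [real_inner_comm, real_inner_comm g] at this
      simpa [hJ] using this
    have h2 := congrArg (fun L : Ell2Z →L[ℝ] ℝ => L f) this
    simp only [ContinuousLinearMap.comp_apply, innerSL_apply_apply] at h2
    rw [real_inner_comm, h2, real_inner_comm]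
  constructor
  · intro t
    apply key
    intro τ
    rw [ho]
    simp only [eZ]
    rw [h8_inner]
    simp [lp.single_apply, Pi.single_apply, eq_comm]
  · intro k hk
    rw [key k 0, inner_zero_right]
    intro τ
    rw [ho, if_neg, inner_zero_right]
    rintro rfl
    exact hk rfl

lemma h8_block {p : ℕ} {c d : Fin p} {J K : Ell2Z →L[ℝ] Ell2p p}
    (hJ : ∀ t, J (eZ t) = e2p p (t, c)) (hK : ∀ t, K (eZ t) = e2p p (t, d))
    (D : Ell2p p →L[ℝ] Ell2p p) (M : Ell2Z →L[ℝ] Ell2Z)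
    (hM : ∀ t τ : ℤ, ⟪M (eZ τ), eZ t⟫_ℝ = ⟪D (e2p p (τ, c)), e2p p (t, d)⟫_ℝ) (f : Ell2Z) :
    ∀ g, ⟪D (J f), K g⟫_ℝ = ⟪M f, g⟫_ℝ := by
  intro g
  have : M = (ContinuousLinearMap.adjoint K).comp (D.comp J) := by
    apply h8_clm_ext
    intro τ
    apply h8_vec_ext
    intro t
    rw [hM, ContinuousLinearMap.comp_apply, ContinuousLinearMap.adjoint_inner_left, hK,
      ContinuousLinearMap.comp_apply, hJ]
  rw [this, ContinuousLinearMap.comp_apply, ContinuousLinearMap.adjoint_inner_left,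
    ContinuousLinearMap.comp_apply]

/-- **Theorem 2.1(ii).** The Gram operator of the residual family of the pair
`{a,b}` is the inverse of the 2×2 block operator `[[D_{a,a}, D_{a,b}],[D_{b,a}, D_{b,b}]]`,
with the explicit Schur-complement formulas for its blocks. -/
theorem statement_8
    {H : Type*} [NormedAddCommGroup H] [InnerProductSpace ℝ H] [CompleteSpace H]
    (p : ℕ) (hp : 1 ≤ p) (x : ℤ × Fin p → H)
    (lamInf lamSup : ℝ)
    (hInf : IsGLB (gramQuadSet x) lamInf)
    (hSup : IsLUB (gramQuadSet x) lamSup)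
    (hpos : 0 < lamInf)
    (C : Ell2p p →L[ℝ] Ell2p p)
    (hC : ∀ i j : ℤ × Fin p, ⟪C (e2p p j), e2p p i⟫_ℝ = ⟪x i, x j⟫_ℝ)
    (hCsa : ∀ u v : Ell2p p, ⟪C u, v⟫_ℝ = ⟪u, C v⟫_ℝ)
    (hlo : ∀ v : Ell2p p, lamInf * ‖v‖ ^ 2 ≤ ⟪C v, v⟫_ℝ)
    (hhi : ∀ v : Ell2p p, ⟪C v, v⟫_ℝ ≤ lamSup * ‖v‖ ^ 2)
    (D : Ell2p p →L[ℝ] Ell2p p)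
    (hCD : C.comp D = ContinuousLinearMap.id ℝ (Ell2p p))
    (hDC : D.comp C = ContinuousLinearMap.id ℝ (Ell2p p))
    (a b : Fin p) (hab : a ≠ b)
    (ra rb : ℤ → H)
    (hra : ∀ t : ℤ,
        IsResidual (x '' {k : ℤ × Fin p | k.2 ≠ a ∧ k.2 ≠ b}) (x (t, a)) (ra t))
    (hrb : ∀ t : ℤ,
        IsResidual (x '' {k : ℤ × Fin p | k.2 ≠ a ∧ k.2 ≠ b}) (x (t, b)) (rb t))
    (Daa Dab Dba Dbb DbbInv : Ell2Z →L[ℝ] Ell2Z)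
    (hDaa : ∀ t τ : ℤ, ⟪Daa (eZ τ), eZ t⟫_ℝ = ⟪D (e2p p (τ, a)), e2p p (t, a)⟫_ℝ)
    (hDab : ∀ t τ : ℤ, ⟪Dab (eZ τ), eZ t⟫_ℝ = ⟪D (e2p p (τ, b)), e2p p (t, a)⟫_ℝ)
    (hDba : ∀ t τ : ℤ, ⟪Dba (eZ τ), eZ t⟫_ℝ = ⟪D (e2p p (τ, a)), e2p p (t, b)⟫_ℝ)
    (hDbb : ∀ t τ : ℤ, ⟪Dbb (eZ τ), eZ t⟫_ℝ = ⟪D (e2p p (τ, b)), e2p p (t, b)⟫_ℝ)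
    (hDbbInv₁ : Dbb.comp DbbInv = ContinuousLinearMap.id ℝ Ell2Z)
    (hDbbInv₂ : DbbInv.comp Dbb = ContinuousLinearMap.id ℝ Ell2Z) :
    (∃ Taa Tab Tba Tbb : Ell2Z →L[ℝ] Ell2Z,
      -- `T` is a two-sided inverse of the 2×2 block operator
      (Daa.comp Taa + Dab.comp Tba = ContinuousLinearMap.id ℝ Ell2Z) ∧
      (Daa.comp Tab + Dab.comp Tbb = 0) ∧
      (Dba.comp Taa + Dbb.comp Tba = 0) ∧
      (Dba.comp Tab + Dbb.comp Tbb = ContinuousLinearMap.id ℝ Ell2Z) ∧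
      (Taa.comp Daa + Tab.comp Dba = ContinuousLinearMap.id ℝ Ell2Z) ∧
      (Taa.comp Dab + Tab.comp Dbb = 0) ∧
      (Tba.comp Daa + Tbb.comp Dba = 0) ∧
      (Tba.comp Dab + Tbb.comp Dbb = ContinuousLinearMap.id ℝ Ell2Z) ∧
      -- and `T` is the Gram operator of the residual family
      (∀ t τ : ℤ, ⟪Taa (eZ τ), eZ t⟫_ℝ = ⟪ra t, ra τ⟫_ℝ) ∧
      (∀ t τ : ℤ, ⟪Tab (eZ τ), eZ t⟫_ℝ = ⟪ra t, rb τ⟫_ℝ) ∧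
      (∀ t τ : ℤ, ⟪Tba (eZ τ), eZ t⟫_ℝ = ⟪rb t, ra τ⟫_ℝ) ∧
      (∀ t τ : ℤ, ⟪Tbb (eZ τ), eZ t⟫_ℝ = ⟪rb t, rb τ⟫_ℝ)) ∧
    (∃ SInv : Ell2Z →L[ℝ] Ell2Z,
      (Daa - Dab.comp (DbbInv.comp Dba)).comp SInv = ContinuousLinearMap.id ℝ Ell2Z ∧
      SInv.comp (Daa - Dab.comp (DbbInv.comp Dba)) = ContinuousLinearMap.id ℝ Ell2Z ∧
      (∀ t τ : ℤ, ⟪ra t, rb τ⟫_ℝ =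
          ⟪(-(SInv.comp (Dab.comp DbbInv))) (eZ τ), eZ t⟫_ℝ) ∧
      (∀ t τ : ℤ, ⟪ra t, ra τ⟫_ℝ = ⟪SInv (eZ τ), eZ t⟫_ℝ)) := by
  obtain ⟨Ja, hJa⟩ := h8_J p a
  obtain ⟨Jb, hJb⟩ := h8_J p b
  have iA := h8_J_inner hJa
  have iB := h8_J_inner hJb
  have bAA := h8_block hJa hJa D Daa hDaa
  have bAB := h8_block hJb hJa D Dab hDab
  have bBA := h8_block hJa hJb D Dba hDba
  have bBB := h8_block hJb hJb D Dbb hDbb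
  have hCD' : ∀ w, C (D w) = w := fun w => by
    have := congrArg (fun L : Ell2p p →L[ℝ] Ell2p p => L w) hCD
    simpa using this
  have hE : ∀ f, Dbb (DbbInv f) = f := fun w => by
    have := congrArg (fun L : Ell2Z →L[ℝ] Ell2Z => L w) hDbbInv₁
    simpa using this
  -- coercivity of D
  have hDco : ∀ w, (lamInf / (‖C‖ + 1) ^ 2) * ‖w‖ ^ 2 ≤ ⟪D w, w⟫_ℝ := by
    intro w
    have h1 := hlo (D w)
    rw [hCD', real_inner_comm] at h1
    refine le_trans ?_ h1
    have h2 : ‖w‖ ≤ (‖C‖ + 1) * ‖D w‖ := by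
      have := C.le_opNorm (D w)
      rw [hCD'] at this
      nlinarith [norm_nonneg (D w)]
    have h3 : ‖w‖ ^ 2 ≤ (‖C‖ + 1) ^ 2 * ‖D w‖ ^ 2 := by
      rw [← mul_pow]; exact pow_le_pow_left₀ (norm_nonneg _) h2 2
    rw [div_mul_eq_mul_div, div_le_iff₀ (by positivity)]
    nlinarith
  have hcpos : 0 < lamInf / (‖C‖ + 1) ^ 2 := by positivity
  set c := lamInf / (‖C‖ + 1) ^ 2 with hc
  -- inner products of J's
  have jAA : ∀ f g, ⟪Ja f, Ja g⟫_ℝ = ⟪f, g⟫_ℝ := by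
    intro f g
    have : (ContinuousLinearMap.adjoint Ja) (Ja f) = f := by
      apply h8_vec_ext
      intro t
      rw [ContinuousLinearMap.adjoint_inner_left, hJa, (iA f).1]
    rw [← ContinuousLinearMap.adjoint_inner_left, this]
  have jBA : ∀ f g, ⟪Jb f, Ja g⟫_ℝ = 0 := by
    intro f g
    have : (ContinuousLinearMap.adjoint Ja) (Jb f) = 0 := by
      apply h8_vec_ext
      intro t
      rw [ContinuousLinearMap.adjoint_inner_left, hJa, (iB f).2 _ hab, inner_zero_left]
    rw [← ContinuousLinearMap.adjoint_inner_left, this, inner_zero_left]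
  -- invertibility of the Schur complement
  have hS : IsUnit (Daa - Dab.comp (DbbInv.comp Dba)) := by
    refine ContinuousLinearMap.isUnit_of_forall_le_norm_inner_map _ (c := ⟨c, hcpos.le⟩) hcpos ?_
    intro u
    set w : Ell2p p := Ja u - Jb (DbbInv (Dba u)) with hw
    have e1 : ⟪D w, w⟫_ℝ = ⟪(Daa - Dab.comp (DbbInv.comp Dba)) u, u⟫_ℝ := by
      have hz : ⟪D w, Jb (DbbInv (Dba u))⟫_ℝ = 0 := by
        rw [hw, map_sub, inner_sub_left, bBA, bBB, hE, sub_self]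
      conv_lhs => rw [hw, inner_sub_right, ← hw, hz, sub_zero]
      rw [hw, map_sub, inner_sub_left, bAA, bAB, ← inner_sub_left]
      rfl
    have e2 : ‖u‖ ^ 2 ≤ ‖w‖ ^ 2 := by
      have h1 : ⟪w, Ja u⟫_ℝ = ‖u‖ ^ 2 := by
        rw [hw, inner_sub_left, jAA, jBA, sub_zero, real_inner_self_eq_norm_sq]
      have h2 : ‖Ja u‖ ^ 2 = ‖u‖ ^ 2 := by
        rw [← real_inner_self_eq_norm_sq, jAA, real_inner_self_eq_norm_sq]
      have h3 : ‖Ja u‖ = ‖u‖ := by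
        rwa [sq_eq_sq₀ (norm_nonneg _) (norm_nonneg _)] at h2
      have h4 := real_inner_le_norm w (Ja u)
      rw [h1, h3] at h4
      nlinarith [sq_nonneg (‖w‖ - ‖u‖)]
    rw [← e1]
    refine le_trans ?_ (Real.le_norm_self _)
    refine le_trans ?_ (hDco w)
    change ‖u‖ ^ 2 * c ≤ c * ‖w‖ ^ 2
    rw [mul_comm]
    gcongr
  obtain ⟨SI, h3, h4⟩ := isUnit_iff_exists.1 hS
  obtain ⟨r1, r2, r3, r4, r5, r6, r7, r8⟩ := h8_ring (A := Daa) (B := Dab) (C := Dba) (E := Dbb)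
    (F := DbbInv) (T := SI) hDbbInv₁ hDbbInv₂ h3 h4
  -- Gram entries
  have col : ∀ (j : ℤ × Fin p) (f g : Ell2Z) (r : H),
      IsResidual (x '' {k : ℤ × Fin p | k.2 ≠ a ∧ k.2 ≠ b}) (x j) r →
      (∀ t, ⟪Daa f + Dab g, eZ t⟫_ℝ = ⟪e2p p j, e2p p (t, a)⟫_ℝ) →
      (∀ t, ⟪Dba f + Dbb g, eZ t⟫_ℝ = ⟪e2p p j, e2p p (t, b)⟫_ℝ) →
      (∀ t, ⟪f, eZ t⟫_ℝ = ⟪ra t, r⟫_ℝ) ∧ (∀ t, ⟪g, eZ t⟫_ℝ = ⟪rb t, r⟫_ℝ) := by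
    intro j f g r hr h1 h2
    have main := h8_res p x C hC {k : ℤ × Fin p | k.2 ≠ a ∧ k.2 ≠ b} j (D (Ja f + Jb g))
      (by
        rintro ⟨t, d⟩ hi
        have hd : d = a ∨ d = b := by
          by_contra hcon
          exact hi (not_or.1 hcon)
        rcases hd with rfl | rfl
        · rw [← h1, ← hJa, map_add, inner_add_left, bAA, bAB, inner_add_left]
        · rw [← h2, ← hJb, map_add, inner_add_left, bBA, bBB, inner_add_left])
      (by
        intro k hk
        rw [hCD', inner_add_left, (iA f).2 k hk.1, (iB g).2 k hk.2, add_zero])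
      r hr
    constructor
    · intro t
      rw [main (t, a) (ra t) (hra t), hCD', inner_add_left, (iA f).1, (iB g).2 _ hab, add_zero]
    · intro t
      rw [main (t, b) (rb t) (hrb t), hCD', inner_add_left, (iB g).1, (iA f).2 _ hab.symm, zero_add]
  have ap : ∀ {M N : Ell2Z →L[ℝ] Ell2Z}, M = N → ∀ f, M f = N f := fun h f => by rw [h]
  have colA := fun τ => col (τ, a) (SI (eZ τ)) ((-(DbbInv * Dba * SI)) (eZ τ)) (ra τ) (hra τ)
    (fun t => by
      have := ap r1 (eZ τ)
      change Daa (SI (eZ τ)) + Dab ((-(DbbInv * Dba * SI)) (eZ τ)) = eZ τ at this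
      rw [this, ← hJa τ, (iA _).1])
    (fun t => by
      have := ap r3 (eZ τ)
      change Dba (SI (eZ τ)) + Dbb ((-(DbbInv * Dba * SI)) (eZ τ)) = 0 at this
      rw [this, ← hJa τ, (iA _).2 _ hab.symm, inner_zero_left])
  have colB := fun τ => col (τ, b) ((-(SI * (Dab * DbbInv))) (eZ τ))
    ((DbbInv + DbbInv * Dba * SI * Dab * DbbInv) (eZ τ)) (rb τ) (hrb τ)
    (fun t => by
      have := ap r2 (eZ τ)
      change Daa ((-(SI * (Dab * DbbInv))) (eZ τ)) +
        Dab ((DbbInv + DbbInv * Dba * SI * Dab * DbbInv) (eZ τ)) = 0 at this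
      rw [this, ← hJb τ, (iB _).2 _ hab, inner_zero_left])
    (fun t => by
      have := ap r4 (eZ τ)
      change Dba ((-(SI * (Dab * DbbInv))) (eZ τ)) +
        Dbb ((DbbInv + DbbInv * Dba * SI * Dab * DbbInv) (eZ τ)) = eZ τ at this
      rw [this, ← hJb τ, (iB _).1])
  refine ⟨⟨SI, -(SI * (Dab * DbbInv)), -(DbbInv * Dba * SI),
    DbbInv + DbbInv * Dba * SI * Dab * DbbInv, r1, r2, r3, r4, r5, r6, r7, r8,
    fun t τ => (colA τ).1 t, fun t τ => (colB τ).1 t, fun t τ => (colA τ).2 t,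
    fun t τ => (colB τ).2 t⟩, ⟨SI, h3, h4, fun t τ => ((colB τ).1 t).symm,
    fun t τ => ((colA τ).1 t).symm⟩⟩
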